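/- Assume the interpolant is linear, I_t(x0,x1) = a_t x0 + b_t x1, with a_t, b_t continuously differentiable on [0,1] and a_0 = 1, a_1 = 0, b_0 = 0, b_1 = 1, and assume ρ0 and ρ1 have finite first moments. Then the probability currents at the endpoints are j_{t=0}(x) = ȧ_0 x ρ0(x) + ḃ_0 ρ0(x) ∫ x1 ρ1(x1) dx1 and j_{t=1}(x) = ḃ_1 x ρ1(x) + ȧ_1 ρ1(x) ∫ x0 ρ0(x0) dx0; consequently v_0(x) = ȧ_0 x + ḃ_0 ∫ x1 ρ1(x1) dx1 wherever ρ0(x) > 0, and v_1(x) = ḃ_1 x + ȧ_1 ∫ x0 ρ0(x0) dx0 wherever ρ1(x) > 0. In particular, for the trigonometric choice a_t = cos(πt/2), b_t = sin(πt/2): v_0(x) = (π/2) ∫ x1 ρ1(x1) dx1 and v_1(x) = −(π/2) ∫ x0 ρ0(x0) dx0. -/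

import Mathlib

open MeasureTheory Real Set
open scoped RealInnerProductSpace ENNReal

/-- The measure on `ℝ^d` with Lebesgue density `ρ`. -/
noncomputable def densMeasure {d : ℕ} (ρ : EuclideanSpace ℝ (Fin d) → ℝ) :
    Measure (EuclideanSpace ℝ (Fin d)) :=
  volume.withDensity fun x => ENNReal.ofReal (ρ x)

/-- Continuous fields with the same integrals against compactly supported continuous test
functions are equal. -/
theorem eq_of_integral_smul_eq {d : ℕ} {F : Type*} [NormedAddCommGroup F] [NormedSpace ℝ F]
    [CompleteSpace F]
    {f g : EuclideanSpace ℝ (Fin d) → F} (hf : Continuous f) (hg : Continuous g)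
    (h : ∀ φ : EuclideanSpace ℝ (Fin d) → ℝ, Continuous φ → HasCompactSupport φ →
      ∫ x, φ x • f x = ∫ x, φ x • g x) : f = g :=
  (hf.ae_eq_iff_eq volume hg).1 <|
    ae_eq_of_integral_contDiff_smul_eq hf.locallyIntegrable hg.locallyIntegrable
      fun φ hφ hφc => h φ hφ.continuous hφc

/-- Averaging `p • x + q` against `r ρ`, for `ρ` a probability density with finite first moment. -/
theorem integral_density_smul_affine {d : ℕ} {ρ : EuclideanSpace ℝ (Fin d) → ℝ}
    (hm : ∫ x, ρ x = 1) (hmom : Integrable fun x : EuclideanSpace ℝ (Fin d) => ρ x • x)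
    (r p : ℝ) (q : EuclideanSpace ℝ (Fin d)) :
    ∫ x, (r * ρ x) • (p • x + q) = r • (p • (∫ x, ρ x • x) + q) := by
  have hρ : Integrable ρ := .of_integral_ne_zero (by simp [hm])
  calc ∫ x, (r * ρ x) • (p • x + q) = ∫ x, r • (p • (ρ x • x) + ρ x • q) := by
        congr 1 with x : 1
        module
    _ = r • (p • (∫ x, ρ x • x) + q) := by
        rw [integral_smul, integral_add (hmom.fun_smul p) (hρ.smul_const q), integral_smul,
          integral_smul_const, hm, one_smul]

/-- Integrating `p • x0 + q • x1` against a test function of `x0` alone times the product density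
amounts to integrating the test function against `ρ0 x • (p • x + q • m1)`,
where `m1` is the mean of `ρ1`. -/
theorem integral_integral_test_fst {d : ℕ} {ρ0 ρ1 : EuclideanSpace ℝ (Fin d) → ℝ}
    (hm1 : ∫ x, ρ1 x = 1) (hmom1 : Integrable fun x : EuclideanSpace ℝ (Fin d) => ρ1 x • x)
    (φ : EuclideanSpace ℝ (Fin d) → ℝ) (p q : ℝ) :
    ∫ x0, ∫ x1, (φ x0 * (ρ0 x0 * ρ1 x1)) • (p • x0 + q • x1) =
      ∫ x, φ x • ((p * ρ0 x) • x + (q * ρ0 x) • ∫ x1, ρ1 x1 • x1) := by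
  congr 1 with x0 : 1
  simp_rw [← mul_assoc, add_comm (p • x0)]
  rw [integral_density_smul_affine hm1 hmom1]
  module

/-- The analogue of `integral_integral_test_fst` for a test function of `x1` alone. -/
theorem integral_integral_test_snd {d : ℕ} {ρ0 ρ1 : EuclideanSpace ℝ (Fin d) → ℝ}
    (hm0 : ∫ x, ρ0 x = 1) (hmom0 : Integrable fun x : EuclideanSpace ℝ (Fin d) => ρ0 x • x)
    (hρ1 : Continuous ρ1) {φ : EuclideanSpace ℝ (Fin d) → ℝ} (hφ : Continuous φ)
    (hφc : HasCompactSupport φ) (p q : ℝ) :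
    ∫ x0, ∫ x1, (φ x1 * (ρ0 x0 * ρ1 x1)) • (p • x0 + q • x1) =
      ∫ x, φ x • ((q * ρ1 x) • x + (p * ρ1 x) • ∫ x0, ρ0 x0 • x0) := by
  have h1 : Integrable fun x => φ x * ρ1 x :=
    (hφ.mul hρ1).integrable_of_hasCompactSupport hφc.mul_right
  have h2 : Integrable fun x : EuclideanSpace ℝ (Fin d) => (φ x * ρ1 x) • x :=
    ((hφ.mul hρ1).smul continuous_id).integrable_of_hasCompactSupport hφc.mul_right.smul_right
  have hsum (u : EuclideanSpace ℝ (Fin d)) (s : ℝ) :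
      ∫ x, (φ x * ρ1 x) • (u + s • x) =
        (∫ x, φ x * ρ1 x) • u + s • ∫ x, (φ x * ρ1 x) • x := by
    rw [← integral_smul_const, ← integral_smul, ← integral_add (h1.smul_const u) (h2.fun_smul s)]
    congr 1 with x : 1
    module
  calc ∫ x0, ∫ x1, (φ x1 * (ρ0 x0 * ρ1 x1)) • (p • x0 + q • x1)
      = ∫ x0, (1 * ρ0 x0) • (((∫ x, φ x * ρ1 x) * p) • x0 +
          q • ∫ x, (φ x * ρ1 x) • x) := by
        congr 1 with x0 : 1
        rw [mul_smul _ p x0, ← hsum (p • x0) q, ← integral_smul]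
        congr 1 with x : 1
        module
    _ = ∫ x, (φ x * ρ1 x) • (p • (∫ x0, ρ0 x0 • x0) + q • x) := by
        rw [integral_density_smul_affine hm0 hmom0, hsum _ q]
        module
    _ = _ := by
        congr 1 with x : 1
        module

/-- For a linear interpolant and densities with finite first moments, the
endpoint currents are `j_0(x) = ȧ_0 x ρ0(x) + ḃ_0 ρ0(x) ∫ x1 ρ1` and
`j_1(x) = ḃ_1 x ρ1(x) + ȧ_1 ρ1(x) ∫ x0 ρ0`; hence `v_0(x) = ȧ_0 x + ḃ_0 ∫ x1 ρ1` on
`{ρ0 > 0}` and `v_1(x) = ḃ_1 x + ȧ_1 ∫ x0 ρ0` on `{ρ1 > 0}`. For the trigonometric choice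
these become `v_0(x) = (π/2) ∫ x1 ρ1` and `v_1(x) = -(π/2) ∫ x0 ρ0`. -/
theorem endpoint_velocities
    (d : ℕ) (ρ0 ρ1 : EuclideanSpace ℝ (Fin d) → ℝ)
    (hρ0nn : ∀ x, 0 ≤ ρ0 x) (hρ0m : ∫ x, ρ0 x = 1) (hρ0C1 : ContDiff ℝ 1 ρ0)
    (hρ1nn : ∀ x, 0 ≤ ρ1 x) (hρ1m : ∫ x, ρ1 x = 1) (hρ1C1 : ContDiff ℝ 1 ρ1)
    -- finite first moments
    (hmom0 : Integrable fun x : EuclideanSpace ℝ (Fin d) => ρ0 x • x)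
    (hmom1 : Integrable fun x : EuclideanSpace ℝ (Fin d) => ρ1 x • x)
    -- a linear interpolant `I_t(x0,x1) = a_t x0 + b_t x1`
    (a b da db : ℝ → ℝ)
    (ha' : ∀ t, HasDerivAt a (da t) t) (hb' : ∀ t, HasDerivAt b (db t) t)
    (hdaC : ContinuousOn da (Icc (0:ℝ) 1)) (hdbC : ContinuousOn db (Icc (0:ℝ) 1))
    (ha0 : a 0 = 1) (ha1 : a 1 = 0) (hb0 : b 0 = 0) (hb1 : b 1 = 1)
    (I : ℝ → EuclideanSpace ℝ (Fin d) → EuclideanSpace ℝ (Fin d) → EuclideanSpace ℝ (Fin d))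
    (hI : ∀ t x0 x1, I t x0 x1 = a t • x0 + b t • x1)
    (dI : ℝ → EuclideanSpace ℝ (Fin d) → EuclideanSpace ℝ (Fin d) → EuclideanSpace ℝ (Fin d))
    (hdI : ∀ t x0 x1, dI t x0 x1 = da t • x0 + db t • x1)
    -- `E[|∂_t I_t(x0,x1)|²] < ∞`
    (hdIL2 : (∫⁻ t in Icc (0:ℝ) 1, ∫⁻ x0, ∫⁻ x1,
      ENNReal.ofReal (‖dI t x0 x1‖ ^ 2 * (ρ0 x0 * ρ1 x1))) < ⊤)
    -- absolute integrability of the characteristic function of `x_t`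
    (hF1 : ∀ t ∈ Icc (0:ℝ) 1, Integrable fun k : EuclideanSpace ℝ (Fin d) =>
      ∫ x0, ∫ x1, Complex.exp (Complex.I * (⟪k, I t x0 x1⟫ : ℝ)) * (ρ0 x0 : ℂ) * (ρ1 x1 : ℂ))
    -- absolute integrability of the Fourier transform of the current
    (hF2 : ∀ t ∈ Icc (0:ℝ) 1, Integrable fun k : EuclideanSpace ℝ (Fin d) =>
      ∫ x0, ∫ x1, (fun i => (dI t x0 x1 i : ℂ) *
        Complex.exp (Complex.I * (⟪k, I t x0 x1⟫ : ℝ)) * (ρ0 x0 : ℂ) * (ρ1 x1 : ℂ) :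
        Fin d → ℂ))
    -- `ρ_t` is the (continuous) probability density of `x_t = I_t(x0,x1)`
    (ρt : ℝ → EuclideanSpace ℝ (Fin d) → ℝ)
    (hρt : ∀ t ∈ Icc (0:ℝ) 1,
      Measure.map (fun p : EuclideanSpace ℝ (Fin d) × EuclideanSpace ℝ (Fin d) => I t p.1 p.2)
        ((densMeasure ρ0).prod (densMeasure ρ1)) = densMeasure (ρt t))
    (hρtC : ∀ t ∈ Icc (0:ℝ) 1, Continuous (ρt t))
    -- the (continuous) probability current, defined weakly against test functions
    (j : ℝ → EuclideanSpace ℝ (Fin d) → EuclideanSpace ℝ (Fin d))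
    (hj : ∀ t ∈ Icc (0:ℝ) 1, ∀ φ : EuclideanSpace ℝ (Fin d) → ℝ,
      Continuous φ → HasCompactSupport φ →
      ∫ x, φ x • j t x = ∫ x0, ∫ x1, (φ (I t x0 x1) * (ρ0 x0 * ρ1 x1)) • dI t x0 x1)
    (hjC : ∀ t ∈ Icc (0:ℝ) 1, Continuous (j t))
    -- the velocity field `v = j/ρ` on `{ρ > 0}`, zero elsewhere
    (v : ℝ → EuclideanSpace ℝ (Fin d) → EuclideanSpace ℝ (Fin d))
    (hv : ∀ t x, v t x = if 0 < ρt t x then (ρt t x)⁻¹ • j t x else 0)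
    -- boundary values of the interpolant density
    (hρt0 : ∀ x, ρt 0 x = ρ0 x) (hρt1 : ∀ x, ρt 1 x = ρ1 x) :
    (∀ x, j 0 x = (da 0 * ρ0 x) • x + (db 0 * ρ0 x) • ∫ x1, ρ1 x1 • x1) ∧
    (∀ x, j 1 x = (db 1 * ρ1 x) • x + (da 1 * ρ1 x) • ∫ x0, ρ0 x0 • x0) ∧
    (∀ x, 0 < ρ0 x → v 0 x = da 0 • x + db 0 • ∫ x1, ρ1 x1 • x1) ∧
    (∀ x, 0 < ρ1 x → v 1 x = db 1 • x + da 1 • ∫ x0, ρ0 x0 • x0) ∧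
    ((∀ t, a t = Real.cos (π * t / 2)) → (∀ t, b t = Real.sin (π * t / 2)) →
      (∀ x, 0 < ρ0 x → v 0 x = (π / 2) • ∫ x1, ρ1 x1 • x1) ∧
      (∀ x, 0 < ρ1 x → v 1 x = (-(π / 2)) • ∫ x0, ρ0 x0 • x0)) := by
  have h0 : (0:ℝ) ∈ Icc (0:ℝ) 1 := by simp
  have h1 : (1:ℝ) ∈ Icc (0:ℝ) 1 := by simp
  have hρ0c := hρ0C1.continuous
  have hρ1c := hρ1C1.continuous
  have hj0 : ∀ x, j 0 x = (da 0 * ρ0 x) • x + (db 0 * ρ0 x) • ∫ x1, ρ1 x1 • x1 := by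
    refine congrFun (eq_of_integral_smul_eq (hjC 0 h0) (by fun_prop) fun φ hφ hφc => ?_)
    rw [hj 0 h0 φ hφ hφc, ← integral_integral_test_fst hρ1m hmom1]
    simp [hI, hdI, ha0, hb0]
  have hj1 : ∀ x, j 1 x = (db 1 * ρ1 x) • x + (da 1 * ρ1 x) • ∫ x0, ρ0 x0 • x0 := by
    refine congrFun (eq_of_integral_smul_eq (hjC 1 h1) (by fun_prop) fun φ hφ hφc => ?_)
    rw [hj 1 h1 φ hφ hφc, ← integral_integral_test_snd hρ0m hmom0 hρ1c hφ hφc]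
    simp [hI, hdI, ha1, hb1]
  have hdiv (r p q : ℝ) (hr : 0 < r) (x m : EuclideanSpace ℝ (Fin d)) :
      r⁻¹ • ((p * r) • x + (q * r) • m) = p • x + q • m := by
    rw [smul_add, smul_smul, smul_smul, mul_comm p, mul_comm q, inv_mul_cancel_left₀ hr.ne',
      inv_mul_cancel_left₀ hr.ne']
  have hv0 : ∀ x, 0 < ρ0 x → v 0 x = da 0 • x + db 0 • ∫ x1, ρ1 x1 • x1 := fun x hx => by
    rw [hv, hρt0, if_pos hx, hj0, hdiv _ _ _ hx]
  have hv1 : ∀ x, 0 < ρ1 x → v 1 x = db 1 • x + da 1 • ∫ x0, ρ0 x0 • x0 := fun x hx => by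
    rw [hv, hρt1, if_pos hx, hj1, hdiv _ _ _ hx]
  refine ⟨hj0, hj1, hv0, hv1, fun hcos hsin => ?_⟩
  have hlin (t : ℝ) : HasDerivAt (fun t : ℝ => π * t / 2) (π / 2) t := by
    simpa using ((hasDerivAt_id t).const_mul π).div_const 2
  have hda (t : ℝ) : da t = -Real.sin (π * t / 2) * (π / 2) :=
    (ha' t).unique (funext hcos ▸ (hlin t).cos)
  have hdb (t : ℝ) : db t = Real.cos (π * t / 2) * (π / 2) :=
    (hb' t).unique (funext hsin ▸ (hlin t).sin)
  refine ⟨fun x hx => ?_, fun x hx => ?_⟩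
  · simp [hv0 x hx, hda, hdb]
  · simp [hv1 x hx, hda, hdb]
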